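/- Let G be a finite group, H a subgroup, H\G the set of right cosets, σ : H\G → G a fixed section of the quotient map, and for g ∈ G let β^k_g : (H\G)^k → (H\G)^k be the action sending j to the unique i with H·σ(j_l)⋯σ(j_k)·g⁻¹ = H·σ(i_l)⋯σ(i_k) for all l. Let G act on (H\G)^m by g • (Hx) = H·x·g⁻¹ in each coordinate. Then for every k ≥ 1: (1) the number of orbits of the diagonal H-action by β^k on (H\G)^k × (H\G)^k (i.e. h • (i,j) = (β^k_h i, β^k_h j) for h ∈ H) equals the number of G-orbits of (H\G)^{2k+1}; and (2) the number of orbits of the diagonal H-action by β^k on Y_k equals the number of G-orbits of (H\G)^{2k}. -/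

import Mathlib

/-- The set `H\G` of right cosets of a subgroup `H` of `G`. -/
abbrev RightCoset (G : Type*) [Group G] (H : Subgroup G) :=
  Quotient (QuotientGroup.rightRel H)

/-- The right coset `H·x` of an element `x : G`. -/
def rcMk {G : Type*} [Group G] (H : Subgroup G) (x : G) : RightCoset G H :=
  Quotient.mk (QuotientGroup.rightRel H) x

/-- The partial product `σ(j_{l+1}) σ(j_{l+2}) ⋯ σ(j_k)` of section representatives
of the tail (all entries with 0-based index `≥ l`) of a `k`-tuple of right cosets;
for `l = 0` this is the full product `σ(j_1) ⋯ σ(j_k)`. -/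
def prodTail {G : Type*} [Group G] {H : Subgroup G} {k : ℕ}
    (σ : RightCoset G H → G) (j : Fin k → RightCoset G H) (l : ℕ) : G :=
  ((List.ofFn fun m => σ (j m)).drop l).prod

/-- Right translation `H·x ↦ H·x·g⁻¹` of `G` on the right coset space `H\G`. -/
def rTrans {G : Type*} [Group G] (H : Subgroup G) (g : G) :
    RightCoset G H → RightCoset G H :=
  Quotient.map' (fun x => x * g⁻¹) (fun a b hab => by
    rw [QuotientGroup.rightRel_apply] at hab ⊢
    simpa [mul_inv_rev, mul_assoc] using hab)

section RightTranslation

variable {G : Type*} [Group G] {H : Subgroup G}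

theorem rcMk_eq_rcMk_iff {x y : G} : rcMk H x = rcMk H y ↔ y * x⁻¹ ∈ H := by
  unfold rcMk
  rw [Quotient.eq, QuotientGroup.rightRel_apply]

theorem rcMk_surjective : Function.Surjective (rcMk H) :=
  Quotient.mk_surjective

theorem rcMk_mul_right_cancel {x y z : G} :
    rcMk H (x * z) = rcMk H (y * z) ↔ rcMk H x = rcMk H y := by
  simp [rcMk_eq_rcMk_iff, mul_assoc]

@[simp]
theorem rTrans_rcMk (g x : G) : rTrans H g (rcMk H x) = rcMk H (x * g⁻¹) :=
  rfl

theorem rTrans_one (c : RightCoset G H) : rTrans H 1 c = c := by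
  obtain ⟨x, rfl⟩ := rcMk_surjective c
  simp

theorem rTrans_mul (g h : G) (c : RightCoset G H) :
    rTrans H (g * h) c = rTrans H g (rTrans H h c) := by
  obtain ⟨x, rfl⟩ := rcMk_surjective c
  simp [mul_assoc]

theorem rTrans_rcMk_one_eq_iff {g : G} : rTrans H g (rcMk H 1) = rcMk H 1 ↔ g ∈ H := by
  simp [rcMk_eq_rcMk_iff]

end RightTranslation

/-- The number of classes is unchanged under a map `F` that preserves and reflects the class
relation and meets every class. -/
theorem card_classes_eq_of_map {A B : Type*} (R : A → Set A) (T : B → Set B)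
    (mem_self : ∀ x, x ∈ T x) (eq_of_mem : ∀ x y, y ∈ T x → T y = T x) (F : A → B)
    (mem_iff : ∀ p q, q ∈ R p ↔ F q ∈ T (F p)) (exists_mem : ∀ y, ∃ p, F p ∈ T y) :
    Nat.card {S : Set A // ∃ p, S = R p} = Nat.card {S : Set B // ∃ x, S = T x} := by
  have eq_iff (p q : A) : R p = R q ↔ T (F p) = T (F q) := by
    constructor
    · intro h
      refine eq_of_mem _ _ ((mem_iff q p).1 ?_)
      rw [← h, mem_iff]
      exact mem_self _
    · intro h
      ext r
      rw [mem_iff, mem_iff, h]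
  refine Nat.card_congr (Equiv.ofBijective
    (fun S => ⟨T (F S.2.choose), _, rfl⟩) ⟨?_, ?_⟩)
  · intro S S' h
    apply Subtype.ext
    rw [S.2.choose_spec, S'.2.choose_spec, eq_iff]
    exact congrArg Subtype.val h
  · rintro ⟨_, y, rfl⟩
    obtain ⟨p, hp⟩ := exists_mem y
    refine ⟨⟨R p, p, rfl⟩, Subtype.ext ?_⟩
    have hex : ∃ q, R p = R q := ⟨p, rfl⟩
    exact ((eq_iff _ _).1 hex.choose_spec).symm.trans (eq_of_mem _ _ hp)

/-- The `H`-orbits on `(H\G)^ι`, transported along a bijection `Ψ : A → (H\G)^ι`, are as many as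
the `G`-orbits on `(H\G)^κ` if `κ` has one element more than `ι`. -/
theorem card_H_orbits_eq_of_bijective {G : Type*} [Group G] (H : Subgroup G) {A ι κ : Type*}
    (e : κ ≃ Option ι) (R : A → Set A) (Ψ : A → ι → RightCoset G H) (hΨ : Function.Bijective Ψ)
    (mem_iff : ∀ p q, q ∈ R p ↔ ∃ h ∈ H, Ψ q = fun m => rTrans H h (Ψ p m)) :
    Nat.card {S : Set A // ∃ p, S = R p} =
      Nat.card {S : Set (κ → RightCoset G H) //
        ∃ x : κ → RightCoset G H, S = {y | ∃ g : G, y = fun m => rTrans H g (x m)}} := by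
  refine card_classes_eq_of_map R
    (fun x : κ → RightCoset G H => {y | ∃ g : G, y = fun m => rTrans H g (x m)}) ?_ ?_
    (fun p m => (e m).elim (rcMk H 1) (Ψ p)) ?_ ?_
  · exact fun x => ⟨1, funext fun m => (rTrans_one _).symm⟩
  · rintro x _ ⟨g, rfl⟩
    ext z
    constructor
    · rintro ⟨g', rfl⟩
      exact ⟨g' * g, funext fun m => (rTrans_mul _ _ _).symm⟩
    · rintro ⟨g', rfl⟩
      refine ⟨g' * g⁻¹, funext fun m => ?_⟩
      rw [← rTrans_mul, inv_mul_cancel_right]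
  · intro p q
    rw [mem_iff]
    constructor
    · rintro ⟨h, hh, hq⟩
      refine ⟨h, funext fun m => ?_⟩
      cases hm : e m with
      | none => simpa using (rTrans_rcMk_one_eq_iff.2 hh).symm
      | some i => simpa using congrFun hq i
    · rintro ⟨g, hg⟩
      refine ⟨g, rTrans_rcMk_one_eq_iff.1 ?_, funext fun i => ?_⟩
      · simpa using (congrFun hg (e.symm none)).symm
      · simpa using congrFun hg (e.symm (some i))
  · intro y
    obtain ⟨x, hx⟩ := rcMk_surjective (y (e.symm none))
    obtain ⟨p, hp⟩ := hΨ.2 fun i => rTrans H x (y (e.symm (some i)))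
    refine ⟨p, x, funext fun m => ?_⟩
    obtain ⟨o, rfl⟩ := e.symm.surjective m
    cases o with
    | none => simp [← hx]
    | some i => simp [hp]

section TailCosets

variable {G : Type*} [Group G] {H : Subgroup G}

theorem prodTail_succ {k : ℕ} (σ : RightCoset G H → G) (j : Fin (k + 1) → RightCoset G H) (l : ℕ) :
    prodTail σ j (l + 1) = prodTail σ (Fin.tail j) l := by
  simp [prodTail, List.ofFn_succ, Fin.tail]

theorem prodTail_zero {k : ℕ} (σ : RightCoset G H → G) (j : Fin (k + 1) → RightCoset G H) :
    prodTail σ j 0 = σ (j 0) * prodTail σ (Fin.tail j) 0 := by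
  simp [prodTail, List.ofFn_succ, Fin.tail]

/-- The cosets `H·σ(j_l)⋯σ(j_k)` of all the tail products of a tuple. -/
def tailCosets {k : ℕ} (σ : RightCoset G H → G) (j : Fin k → RightCoset G H) :
    Fin k → RightCoset G H :=
  fun l => rcMk H (prodTail σ j l)

theorem tailCosets_injective {σ : RightCoset G H → G} (hσ : ∀ c, rcMk H (σ c) = c) (k : ℕ) :
    Function.Injective (tailCosets (k := k) σ) := by
  induction k with
  | zero => exact fun i j _ => Subsingleton.elim i j
  | succ k ih =>
    intro i j hij
    have htail : Fin.tail i = Fin.tail j := by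
      refine ih (funext fun l => ?_)
      simpa [tailCosets, prodTail_succ] using congrFun hij l.succ
    have hhead : i 0 = j 0 := by
      have h := congrFun hij 0
      simp only [tailCosets, Fin.val_zero, prodTail_zero, htail] at h
      rwa [rcMk_mul_right_cancel, hσ, hσ] at h
    rw [← Fin.cons_self_tail i, ← Fin.cons_self_tail j, htail, hhead]

theorem tailCosets_bijective [Finite G] {σ : RightCoset G H → G} (hσ : ∀ c, rcMk H (σ c) = c)
    (k : ℕ) : Function.Bijective (tailCosets (k := k) σ) :=
  Finite.injective_iff_bijective.1 (tailCosets_injective hσ k)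

end TailCosets

/-- Let `G` be a finite group, `H` a subgroup, `σ : H\G → G` a section of
the quotient map, and `β^k` the `G`-action on `(H\G)^k` of the paper (hypothesised here
through its defining property).  Let `G` act on `(H\G)^m` diagonally by right translation
`g • (Hx) = H·x·g⁻¹`.  Then for every `k ≥ 1`:
(1) the number of orbits of the diagonal `H`-action by `β^k` on `(H\G)^k × (H\G)^k` equals
the number of `G`-orbits of `(H\G)^(2k+1)`; and
(2) the number of orbits of the diagonal `H`-action by `β^k` on `Y_k` equals the number of
`G`-orbits of `(H\G)^(2k)`. -/
theorem card_H_orbits_eq_card_G_orbits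
    {G : Type*} [Group G] [Finite G] (H : Subgroup G)
    (σ : RightCoset G H → G) (hσ : ∀ c, rcMk H (σ c) = c)
    (k : ℕ) (hk : 1 ≤ k)
    (β : G → (Fin k → RightCoset G H) → (Fin k → RightCoset G H))
    (hβ : ∀ (g : G) (j : Fin k → RightCoset G H) (l : Fin k),
      rcMk H (prodTail σ j l * g⁻¹) = rcMk H (prodTail σ (β g j) l)) :
    (Nat.card {S : Set ((Fin k → RightCoset G H) × (Fin k → RightCoset G H)) //
          ∃ p : (Fin k → RightCoset G H) × (Fin k → RightCoset G H),
            S = {q | ∃ h ∈ H, q = (β h p.1, β h p.2)}}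
        = Nat.card {S : Set (Fin (2 * k + 1) → RightCoset G H) //
          ∃ x : Fin (2 * k + 1) → RightCoset G H,
            S = {y | ∃ g : G, y = fun m => rTrans H g (x m)}})
      ∧ Nat.card {S : Set {p : (Fin k → RightCoset G H) × (Fin k → RightCoset G H) //
            rcMk H (prodTail σ p.1 0) = rcMk H (prodTail σ p.2 0)} //
          ∃ p : {p : (Fin k → RightCoset G H) × (Fin k → RightCoset G H) //
              rcMk H (prodTail σ p.1 0) = rcMk H (prodTail σ p.2 0)},
            S = {q | ∃ h ∈ H, q.val = (β h p.val.1, β h p.val.2)}}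
        = Nat.card {S : Set (Fin (2 * k) → RightCoset G H) //
          ∃ x : Fin (2 * k) → RightCoset G H,
            S = {y | ∃ g : G, y = fun m => rTrans H g (x m)}} := by
  have hΦ := tailCosets_bijective hσ k
  have eq_β_iff (h : G) (i j : Fin k → RightCoset G H) :
      i = β h j ↔ ∀ l, tailCosets σ i l = rTrans H h (tailCosets σ j l) := by
    rw [← hΦ.1.eq_iff, funext_iff]
    exact forall_congr' fun l => by rw [show tailCosets σ (β h j) l = _ from (hβ h j l).symm]; rfl
  constructor
  · refine card_H_orbits_eq_of_bijective H (ι := Fin k ⊕ Fin k)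
      (Fintype.equivOfCardEq (by simp; ring)) _
      (fun p => Sum.elim (tailCosets σ p.1) (tailCosets σ p.2)) ⟨?_, ?_⟩ ?_
    · intro p q hpq
      exact Prod.ext (hΦ.1 (funext fun l => congrFun hpq (Sum.inl l)))
        (hΦ.1 (funext fun l => congrFun hpq (Sum.inr l)))
    · intro y
      obtain ⟨i, hi⟩ := hΦ.2 (y ∘ Sum.inl)
      obtain ⟨j, hj⟩ := hΦ.2 (y ∘ Sum.inr)
      exact ⟨(i, j), by simp [hi, hj]⟩
    · intro p q
      simp only [Set.mem_ofPred_eq, Prod.ext_iff, eq_β_iff, funext_iff, Sum.forall, Sum.elim_inl,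
        Sum.elim_inr]
  · obtain ⟨k, rfl⟩ := Nat.exists_eq_add_of_le' hk
    refine card_H_orbits_eq_of_bijective H (ι := Fin (k + 1) ⊕ Fin k)
      (Fintype.equivOfCardEq (by simp; ring)) _
      (fun p => Sum.elim (tailCosets σ p.1.1) (Fin.tail (tailCosets σ p.1.2))) ⟨?_, ?_⟩ ?_
    · intro p q hpq
      have h₁ : tailCosets σ p.1.1 = tailCosets σ q.1.1 :=
        funext fun l => congrFun hpq (Sum.inl l)
      refine Subtype.ext (Prod.ext (hΦ.1 h₁) (hΦ.1 (funext (Fin.cases ?_ fun l => ?_))))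
      · exact p.2.symm.trans ((congrFun h₁ 0).trans q.2)
      · exact congrFun hpq (Sum.inr l)
    · intro y
      obtain ⟨i, hi⟩ := hΦ.2 (y ∘ Sum.inl)
      obtain ⟨j, hj⟩ := hΦ.2 (Fin.cons (y (Sum.inl 0)) (y ∘ Sum.inr))
      refine ⟨⟨(i, j), (congrFun hi 0).trans (congrFun hj 0).symm⟩, ?_⟩
      simp [hi, hj]
    · intro p q
      simp only [Set.mem_ofPred_eq, Prod.ext_iff, eq_β_iff, funext_iff, Sum.forall, Sum.elim_inl,
        Sum.elim_inr]
      refine exists_congr fun h => and_congr_right fun _ => and_congr_right fun h₁ => ?_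
      refine Fin.forall_fin_succ.trans (and_iff_right ?_)
      have hp : tailCosets σ p.1.1 0 = tailCosets σ p.1.2 0 := p.2
      have hq : tailCosets σ q.1.1 0 = tailCosets σ q.1.2 0 := q.2
      rw [← hp, ← hq, h₁]
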